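/- arXiv:0909.0615 — 3 statements merged into one kernel-verified Lean document; each statement's English description precedes it below -/
import Mathlib

section
/- Let D be a division ring and (R, C) a solution of the non-commutative (2,2)-system with commutator C. Set K := R₁ R₀⁻¹ + R₁⁻¹ R₀⁻¹ + R₁⁻¹ R₀. Then the solution satisfies the two linear recursion relations with constant coefficients: R_{n+1} C + R_{n-1} = R_n K and R_{n+1} + C R_{n-1} = K R_n, for all n ∈ ℤ. -/
/-- A solution of the non-commutative `(2,2)`-system with commutator `C`. -/
def IsTwoTwoSolution {D : Type*} [DivisionRing D] (R : ℤ → Dˣ) (C : Dˣ) : Prop :=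
  (∀ n : ℤ, (C : D) =
      (((R (n + 1))⁻¹ : Dˣ) : D) * (R n : D) * (R (n + 1) : D) * (((R n)⁻¹ : Dˣ) : D)) ∧
  (∀ n : ℤ, (R (n + 1) : D) * (C : D) * (R (n - 1) : D) = (R n : D) ^ 2 + 1)

/-- The conserved quantity `R_{n+1} R_n⁻¹ + R_n⁻¹ R_{n-1}`, one step. -/
theorem twotwo_aux {D : Type*} [DivisionRing D] (a b c C : D) (ha : a ≠ 0) (hb : b ≠ 0)
    (hc : c ≠ 0) (h1 : C = a⁻¹ * b * a * b⁻¹) (h2 : C = b⁻¹ * c * b * c⁻¹)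
    (h3 : a * C * c = b ^ 2 + 1) :
    a * C + c = b * (a * b⁻¹ + b⁻¹ * c) ∧ a + C * c = (a * b⁻¹ + b⁻¹ * c) * b ∧
    a * b⁻¹ + b⁻¹ * c = b * c⁻¹ + b⁻¹ * c⁻¹ + b⁻¹ * c ∧
    a * b⁻¹ + b⁻¹ * c = a * b⁻¹ + a⁻¹ * b⁻¹ + a⁻¹ * b := by
  have e1 : a * C = b * a * b⁻¹ := by
    rw [h1]; simp only [← mul_assoc]; rw [mul_inv_cancel₀ ha, one_mul]
  have e2 : C * c = b⁻¹ * c * b := by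
    rw [h2, mul_assoc, inv_mul_cancel₀ hc, mul_one]
  have e3 : a * b⁻¹ * c = b + b⁻¹ := by
    have h4 : a * b⁻¹ * c * b = b ^ 2 + 1 := by
      rw [← h3, mul_assoc a C c, e2]; simp only [mul_assoc]
    calc a * b⁻¹ * c = a * b⁻¹ * c * b * b⁻¹ := by rw [mul_assoc _ b, mul_inv_cancel₀ hb, mul_one]
      _ = b + b⁻¹ := by rw [h4, add_mul, one_mul, pow_two, mul_assoc, mul_inv_cancel₀ hb, mul_one]
  refine ⟨?_, ?_, ?_, ?_⟩
  · rw [e1, mul_add, ← mul_assoc, ← mul_assoc, mul_inv_cancel₀ hb, one_mul]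
  · rw [e2, add_mul, mul_assoc a, inv_mul_cancel₀ hb, mul_one]
  · rw [← add_mul b, ← e3, mul_assoc _ c, mul_inv_cancel₀ hc, mul_one]
  · rw [add_assoc, ← mul_add, add_comm b⁻¹ b, ← e3, mul_assoc a, ← mul_assoc a⁻¹ a,
      inv_mul_cancel₀ ha, one_mul]

/-- The solutions of the `(2,2)`-system satisfy the two linear recursion relations
`R_{n+1} C + R_{n-1} = R_n K` and `R_{n+1} + C R_{n-1} = K R_n`, where
`K = R₁ R₀⁻¹ + R₁⁻¹ R₀⁻¹ + R₁⁻¹ R₀`. -/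
theorem twotwo_linear_recursions {D : Type*} [DivisionRing D] (R : ℤ → Dˣ) (C : Dˣ)
    (h : IsTwoTwoSolution R C) :
    ∀ n : ℤ,
      (R (n + 1) : D) * (C : D) + (R (n - 1) : D) =
        (R n : D) * ((R 1 : D) * (((R 0)⁻¹ : Dˣ) : D) +
          (((R 1)⁻¹ : Dˣ) : D) * (((R 0)⁻¹ : Dˣ) : D) +
          (((R 1)⁻¹ : Dˣ) : D) * (R 0 : D)) ∧
      (R (n + 1) : D) + (C : D) * (R (n - 1) : D) =
        ((R 1 : D) * (((R 0)⁻¹ : Dˣ) : D) +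
          (((R 1)⁻¹ : Dˣ) : D) * (((R 0)⁻¹ : Dˣ) : D) +
          (((R 1)⁻¹ : Dˣ) : D) * (R 0 : D)) * (R n : D) := by
  obtain ⟨hC, hR⟩ := h
  simp only [Units.val_inv_eq_inv_val] at hC ⊢
  have key := fun n : ℤ => twotwo_aux (R (n + 1) : D) (R n : D) (R (n - 1) : D) (C : D)
    (R (n + 1)).ne_zero (R n).ne_zero (R (n - 1)).ne_zero (hC n)
    (by have := hC (n - 1); rwa [sub_add_cancel] at this) (hR n)
  have step : ∀ n : ℤ, (R (n + 1 + 1) : D) * (R (n + 1) : D)⁻¹ + (R (n + 1) : D)⁻¹ * (R n : D) =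
      (R (n + 1) : D) * (R n : D)⁻¹ + (R n : D)⁻¹ * (R (n - 1) : D) := by
    intro n
    have h1 := (key (n + 1)).2.2.1
    rw [add_sub_cancel_right] at h1
    rw [h1, (key n).2.2.2]
  have main : ∀ n : ℤ, (R (n + 1) : D) * (R n : D)⁻¹ + (R n : D)⁻¹ * (R (n - 1) : D) =
      (R 1 : D) * (R 0 : D)⁻¹ + (R 1 : D)⁻¹ * (R 0 : D)⁻¹ + (R 1 : D)⁻¹ * (R 0 : D) := by
    intro n
    induction n using Int.induction_on with
    | zero => simpa using (key 0).2.2.2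
    | succ i ih =>
      rw [add_sub_cancel_right, step, ih]
    | pred i ih =>
      have := step (-(i : ℤ) - 1)
      rw [sub_add_cancel] at this
      rw [sub_add_cancel, ← this, ih]
  intro n
  rw [← main n]
  exact ⟨(key n).1, (key n).2.1⟩
end

section
/- Let D be a division ring, X, Y ∈ Dˣ, and (R, C) a solution of the non-commutative (1,4)-system with commutator C and initial data C = X Y X⁻¹ Y⁻¹, R₁ = Y X Y⁻¹, R₂ = Y. Then for all n ≥ 0 (both even and odd indices), R_n belongs to the subsemiring of D generated by {X, X⁻¹, Y, Y⁻¹}; in particular, for n ≥ 1 the element R_{2n+1} = u_n u_{n+1} − C⁻¹ (with u_n = R_{2n}) lies in this subsemiring, the term C⁻¹ occurring in the Laurent expansion of u_n u_{n+1}. -/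
/-- A solution of the non-commutative `(1,4)`-system with commutator `C`. -/
def IsOneFourSolution {D : Type*} [DivisionRing D] (R : ℤ → Dˣ) (C : Dˣ) : Prop :=
  (∀ n : ℤ, (C : D) =
      (((R (n + 1))⁻¹ : Dˣ) : D) * (R n : D) * (R (n + 1) : D) * (((R n)⁻¹ : Dˣ) : D)) ∧
  (∀ n : ℤ, (R (2 * n) : D) * (C : D) * (R (2 * n - 2) : D) = 1 + (R (2 * n - 1) : D)) ∧
  (∀ n : ℤ, (R (2 * n + 1) : D) * (C : D) * (R (2 * n - 1) : D) = 1 + (R (2 * n) : D) ^ 4)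

/-- The relation `w = x y - C⁻¹`. -/
lemma of_prod {D : Type*} [DivisionRing D] {C Ci x y w : D} (hCi : Ci * C = 1) (hCi' : C * Ci = 1)
    (hy : y ≠ 0) (hC : C ≠ 0)
    (h2 : w * y = y * C * w) (h3 : y * C * x = 1 + w) : x * y = w + Ci := by
  have e : y * C * (x * y) = y * C * (w + Ci) := by
    calc y * C * (x * y) = (y * C * x) * y := by noncomm_ring
      _ = y + w * y := by rw [h3]; noncomm_ring
      _ = y * (C * Ci) + y * C * w := by rw [h2, hCi']; noncomm_ring
      _ = _ := by noncomm_ring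
  exact mul_left_cancel₀ (mul_ne_zero hy hC) e

/-- The cubic three-term relation. -/
lemma cubic {D : Type*} [DivisionRing D] {C Ci x y z v w : D} (hCi : Ci * C = 1) (hCi' : C * Ci = 1)
    (hy : y ≠ 0)
    (h3 : y * C * x = 1 + v) (h4 : x * y = v + Ci) (h5 : z * C * y = 1 + w)
    (h6 : w * C * v = 1 + y ^ 4) : z * C * v = C * x + y ^ 3 := by
  apply mul_right_cancel₀ hy
  have hw : w = z * C * y - 1 := by rw [h5]; noncomm_ring
  have hv : v = x * y - Ci := by rw [h4]; noncomm_ring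
  have hv' : v = y * C * x - 1 := by rw [h3]; noncomm_ring
  have e : (z * C * y - 1) * C * (x * y - Ci) = 1 + y ^ 4 := by rw [← hw, ← hv, h6]
  have e2 : (z * C * y - 1) * C * (x * y - Ci)
      = z * C * (y * C * x) * y - z * C * y * (C * Ci) - C * x * y + C * Ci := by noncomm_ring
  rw [e2, hCi', h3] at e
  have e3 : z * C * v * y = (z * C * (1 + v) * y - z * C * y * 1 - C * x * y + 1)
      + C * x * y - 1 := by noncomm_ring
  rw [e3, e]
  noncomm_ring

lemma lin_left {D : Type*} [DivisionRing D] {C Ci x y z v vi : D} (hCi : Ci * C = 1)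
    (hCi' : C * Ci = 1) (hv : v * vi = 1) (hv' : vi * v = 1)
    (h1 : x * v = v * C * x) (h2 : v * y = y * C * v) (h4 : x * y = v + Ci)
    (h7 : z * C * v = C * x + y ^ 3) : z + C * x = (vi * x ^ 2 + y ^ 2 * vi) * y := by
  have a1 : C * x = vi * x * v := by
    calc C * x = (vi * v) * C * x := by rw [hv', one_mul]
      _ = vi * (v * C * x) := by noncomm_ring
      _ = _ := by rw [← h1]; noncomm_ring
  have a2 : y * vi * Ci = vi * y := by
    calc y * vi * Ci = (vi * v) * y * vi * Ci := by rw [hv', one_mul]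
      _ = vi * (v * y) * vi * Ci := by noncomm_ring
      _ = vi * y * (C * (v * vi) * Ci) := by rw [h2]; noncomm_ring
      _ = _ := by rw [hv, mul_one, hCi', mul_one]
  have a2' : y ^ 3 * vi * Ci = y ^ 2 * vi * y := by
    calc y ^ 3 * vi * Ci = y ^ 2 * (y * vi * Ci) := by noncomm_ring
      _ = _ := by rw [a2]; noncomm_ring
  have a3 : z = vi * x * Ci + y ^ 2 * vi * y := by
    calc z = z * (C * (v * vi) * Ci) := by rw [hv, mul_one, hCi', mul_one]
      _ = (z * C * v) * vi * Ci := by noncomm_ring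
      _ = (C * x) * vi * Ci + y ^ 3 * vi * Ci := by rw [h7]; noncomm_ring
      _ = vi * x * (v * vi) * Ci + y ^ 2 * vi * y := by rw [a1, a2']; noncomm_ring
      _ = _ := by rw [hv, mul_one]
  calc z + C * x = vi * x * (v + Ci) + y ^ 2 * vi * y := by rw [a1, a3]; noncomm_ring
    _ = _ := by rw [← h4]; noncomm_ring

lemma lin_right {D : Type*} [DivisionRing D] {C x y z w wi v : D}
    (hw : w * wi = 1) (hw' : wi * w = 1)
    (h2 : w * z = z * C * w) (h3 : y * C * x = 1 + v) (h5 : z * C * y = 1 + w)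
    (h7 : z * C * v = C * x + y ^ 3) : z + C * x = (wi * y ^ 2 + z ^ 2 * wi) * y := by
  have b0 : w * C * x = y ^ 3 + z * C := by
    calc w * C * x = (1 + w) * C * x - C * x := by noncomm_ring
      _ = z * C * (y * C * x) - C * x := by rw [← h5]; noncomm_ring
      _ = z * C + z * C * v - C * x := by rw [h3]; noncomm_ring
      _ = _ := by rw [h7]; noncomm_ring
  have b1 : C * x = wi * y ^ 3 + wi * z * C := by
    calc C * x = (wi * w) * C * x := by rw [hw', one_mul]
      _ = wi * (w * C * x) := by noncomm_ring
      _ = _ := by rw [b0]; noncomm_ring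
  have b2 : wi * z * C = z * wi := by
    calc wi * z * C = wi * z * C * (w * wi) := by rw [hw, mul_one]
      _ = wi * (z * C * w) * wi := by noncomm_ring
      _ = (wi * w) * z * wi := by rw [← h2]; noncomm_ring
      _ = _ := by rw [hw', one_mul]
  calc z + C * x = z * (wi * w) + (wi * y ^ 3 + wi * z * C) := by rw [hw', b1, mul_one]
    _ = z * wi * (1 + w) + wi * y ^ 3 := by rw [b2]; noncomm_ring
    _ = z * (wi * z * C) * y + wi * y ^ 3 := by rw [← h5]; noncomm_ring
    _ = z * (z * wi) * y + wi * y ^ 3 := by rw [b2]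
    _ = _ := by noncomm_ring

/-- Positivity for the `(1,4)`-system in the `(X,Y)` initial data: `R_n` lies in the
subsemiring of `D` generated by `{X, X⁻¹, Y, Y⁻¹}` for all `n ≥ 0`; in particular for
`n ≥ 1` the term `C⁻¹` occurs in the Laurent expansion of `u_n u_{n+1}`, so that
`R_{2n+1} = u_n u_{n+1} − C⁻¹` lies in this subsemiring. -/
theorem onefour_positivity_XY {D : Type*} [DivisionRing D] (X Y : Dˣ)
    (R : ℤ → Dˣ) (C : Dˣ) (h : IsOneFourSolution R C)
    (hC : C = X * Y * X⁻¹ * Y⁻¹) (hR1 : R 1 = Y * X * Y⁻¹) (hR2 : R 2 = Y) :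
    (∀ n : ℤ, 0 ≤ n →
      (R n : D) ∈ Subsemiring.closure
        ({(X : D), ((X⁻¹ : Dˣ) : D), (Y : D), ((Y⁻¹ : Dˣ) : D)} : Set D)) ∧
    (∀ n : ℤ, 1 ≤ n →
      ∃ p ∈ Subsemiring.closure
        ({(X : D), ((X⁻¹ : Dˣ) : D), (Y : D), ((Y⁻¹ : Dˣ) : D)} : Set D),
        (R (2 * n) : D) * (R (2 * (n + 1)) : D) = p + ((C⁻¹ : Dˣ) : D) ∧
        (R (2 * n + 1) : D) = p) := by
  obtain ⟨hi, hii, hiii⟩ := h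
  set S := Subsemiring.closure
        ({(X : D), ((X⁻¹ : Dˣ) : D), (Y : D), ((Y⁻¹ : Dˣ) : D)} : Set D) with hS
  have mX : (X : D) ∈ S := Subsemiring.subset_closure (by simp)
  have mXi : ((X⁻¹ : Dˣ) : D) ∈ S := Subsemiring.subset_closure (by simp)
  have mY : (Y : D) ∈ S := Subsemiring.subset_closure (by simp)
  have mYi : ((Y⁻¹ : Dˣ) : D) ∈ S := Subsemiring.subset_closure (by simp)
  -- basic relations
  have hcomm : ∀ n : ℤ, (R n : D) * R (n + 1) = R (n + 1) * C * R n := by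
    intro n
    rw [hi n]
    simp [mul_assoc]
  have c1 : ∀ n : ℤ, (R (2 * n) : D) * R (2 * n + 1) = R (2 * n + 1) * C * R (2 * n) :=
    fun n => hcomm _
  have c2 : ∀ n : ℤ, (R (2 * n + 1) : D) * R (2 * (n + 1))
      = R (2 * (n + 1)) * C * R (2 * n + 1) := by
    intro n
    have := hcomm (2 * n + 1)
    rwa [show 2 * n + 1 + 1 = 2 * (n + 1) by ring] at this
  have c3 : ∀ n : ℤ, (R (2 * (n + 1)) : D) * C * R (2 * n) = 1 + R (2 * n + 1) := by
    intro n
    have := hii (n + 1)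
    rwa [show 2 * (n + 1) - 2 = 2 * n by ring, show 2 * (n + 1) - 1 = 2 * n + 1 by ring] at this
  have c4 : ∀ n : ℤ, (R (2 * n) : D) * R (2 * (n + 1)) = R (2 * n + 1) + ((C⁻¹ : Dˣ) : D) :=
    fun n => of_prod (D := D) (C := (C : D)) (by simp) (by simp) (Units.ne_zero _) (Units.ne_zero _) (c2 n) (c3 n)
  have c6 : ∀ n : ℤ, (R (2 * (n + 1) + 1) : D) * C * R (2 * n + 1)
      = 1 + (R (2 * (n + 1)) : D) ^ 4 := by
    intro n
    have := hiii (n + 1)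
    rwa [show 2 * (n + 1) - 1 = 2 * n + 1 by ring] at this
  have c7 : ∀ n : ℤ, (R (2 * (n + 1 + 1)) : D) * C * R (2 * n + 1)
      = C * R (2 * n) + (R (2 * (n + 1)) : D) ^ 3 := fun n =>
    cubic (D := D) (Ci := ((C⁻¹ : Dˣ) : D)) (by simp) (by simp) (Units.ne_zero _) (c3 n) (c4 n)
      (c3 (n + 1)) (c6 n)
  -- the conserved quantity
  let K : ℤ → D := fun n => (((R (2 * n + 1))⁻¹ : Dˣ) : D) * (R (2 * n) : D) ^ 2
    + (R (2 * (n + 1)) : D) ^ 2 * (((R (2 * n + 1))⁻¹ : Dˣ) : D)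
  have k1 : ∀ n : ℤ, (R (2 * (n + 1 + 1)) : D) + C * R (2 * n) = K n * R (2 * (n + 1)) := fun n =>
    lin_left (D := D) (Ci := ((C⁻¹ : Dˣ) : D)) (v := R (2 * n + 1)) (by simp) (by simp) (by simp) (by simp)
      (c1 n) (c2 n) (c4 n) (c7 n)
  have k2 : ∀ n : ℤ, (R (2 * (n + 1 + 1)) : D) + C * R (2 * n)
      = K (n + 1) * R (2 * (n + 1)) := fun n =>
    lin_right (D := D) (w := R (2 * (n + 1) + 1)) (by simp) (by simp)
      (c2 (n + 1)) (c3 n) (c3 (n + 1)) (c7 n)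
  have k3 : ∀ n : ℕ, K n = K 0 := by
    intro n
    induction n with
    | zero => rfl
    | succ m ih =>
      rw [← ih]
      push_cast
      exact (mul_right_cancel₀ (Units.ne_zero _) ((k1 m).symm.trans (k2 m))).symm
  have u0 : (R 0 : D) = (Y * X * Y⁻¹ * Y⁻¹ : Dˣ) + (Y * X * Y⁻¹ * X⁻¹ * Y⁻¹ : Dˣ) := by
    have := c4 0
    norm_num at this
    rw [hR1, hR2, hC] at this
    calc (R 0 : D) = (R 0 * Y) * ((Y⁻¹ : Dˣ) : D) := by simp
      _ = _ := by rw [this]; simp [add_mul, mul_assoc]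
  let A : D := (Y ^ 3 * X⁻¹ * Y⁻¹ : Dˣ)
  let B : D := (X * Y⁻¹ * Y⁻¹ : Dˣ)
  let E : D := (X * Y⁻¹ * X⁻¹ * Y⁻¹ : Dˣ) + (Y⁻¹ * Y⁻¹ : Dˣ) + (Y⁻¹ * X⁻¹ * Y⁻¹ : Dˣ)
  let s : D := (X * Y⁻¹ * X⁻¹ : Dˣ)
  have mA : A ∈ S := by
    simp only [A, Units.val_mul, Units.val_pow_eq_pow_val]
    exact mul_mem (mul_mem (pow_mem mY _) mXi) mYi
  have mB : B ∈ S := by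
    simp only [B, Units.val_mul]
    exact mul_mem (mul_mem mX mYi) mYi
  have mE : E ∈ S := by
    simp only [E, Units.val_mul]
    exact add_mem (add_mem (mul_mem (mul_mem (mul_mem mX mYi) mXi) mYi) (mul_mem mYi mYi))
      (mul_mem (mul_mem mYi mXi) mYi)
  have ms : s ∈ S := by
    simp only [s, Units.val_mul]
    exact mul_mem (mul_mem mX mYi) mXi
  have hBA : B * A = C := by
    simp only [A, B, ← Units.val_mul, hC]
    congr 1
    group
  have hAYB : A * Y * B = Y := by
    simp only [A, B, ← Units.val_mul]
    congr 1
    group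
  have hYs : (Y : D) * s = ((C⁻¹ : Dˣ) : D) := by
    simp only [s, ← Units.val_mul, hC]
    congr 1
    group
  have hK0 : K 0 = A + B + E := by
    have : K 0 = (((R 1)⁻¹ : Dˣ) : D) * (R 0 : D) ^ 2 + (R 2 : D) ^ 2 * (((R 1)⁻¹ : Dˣ) : D) := by
      simp [K]
    rw [this, u0, hR1, hR2]
    simp only [A, B, E]
    simp [pow_succ, mul_add, add_mul, mul_assoc]
    abel
  have hu2 : (R (2 * (1 + 1)) : D) = A * Y + (s + (Y⁻¹ * X⁻¹ : Dˣ)) := by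
    have := k1 0
    norm_num at this
    rw [hR2, hK0, u0, hC] at this
    norm_num
    rw [eq_sub_of_add_eq this]
    simp only [A, B, E, s]
    simp [mul_add, add_mul, mul_assoc]
    abel
  -- main induction
  have main : ∀ n : ℕ, ∃ p ∈ S, ∃ q ∈ S, (R (2 * ((n : ℤ) + 1)) : D) = A ^ n * Y + p ∧
      (R (2 * ((n : ℤ) + 1 + 1)) : D) = A * R (2 * ((n : ℤ) + 1)) + (B ^ n * s + q) := by
    intro n
    induction n with
    | zero =>
      refine ⟨0, zero_mem _, ((Y⁻¹ * X⁻¹ : Dˣ) : D), ?_, ?_, ?_⟩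
      · rw [Units.val_mul]; exact mul_mem mYi mXi
      · simp [hR2]
      · have := hu2
        norm_num at this ⊢
        rw [this, hR2]
    | succ m ih =>
      obtain ⟨p, hp, q, hq, e1, e2⟩ := ih
      have mu : (R (2 * ((m : ℤ) + 1)) : D) ∈ S := by
        rw [e1]; exact add_mem (mul_mem (pow_mem mA _) mY) hp
      have mv : B ^ m * s + q ∈ S := add_mem (mul_mem (pow_mem mB _) ms) hq
      have mu' : (R (2 * ((m : ℤ) + 1 + 1)) : D) ∈ S := by
        rw [e2]; exact add_mem (mul_mem mA mu) mv
      refine ⟨A * p + (B ^ m * s + q), add_mem (mul_mem mA hp) mv,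
        B * q + E * R (2 * ((m : ℤ) + 1 + 1)), add_mem (mul_mem mB hq) (mul_mem mE mu'), ?_, ?_⟩
      · push_cast
        rw [e2, e1, pow_succ']
        noncomm_ring
      · push_cast
        have k := k1 ((m : ℤ) + 1)
        have k3' := k3 (m + 1)
        push_cast at k3'
        rw [k3', hK0, ← hBA] at k
        rw [eq_sub_of_add_eq k, pow_succ']
        have e3 : B ^ m * s = R (2 * ((m : ℤ) + 1 + 1)) - A * R (2 * ((m : ℤ) + 1)) - q := by
          rw [e2]; abel
        rw [mul_assoc B (B ^ m) s, e3]
        noncomm_ring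
  have key : ∀ n : ℕ, A ^ n * Y * B ^ n = Y := by
    intro n
    induction n with
    | zero => simp
    | succ m ih =>
      calc A ^ (m + 1) * Y * B ^ (m + 1) = A ^ m * (A * Y * B) * B ^ m := by
            rw [pow_succ A, pow_succ' B]; simp only [mul_assoc]
        _ = _ := by rw [hAYB, ih]
  have meven : ∀ n : ℕ, (R (2 * ((n : ℤ) + 1)) : D) ∈ S := by
    intro n
    obtain ⟨p, hp, q, hq, e1, e2⟩ := main n
    rw [e1]; exact add_mem (mul_mem (pow_mem mA _) mY) hp
  have modd : ∀ n : ℕ, (R (2 * ((n : ℤ) + 1) + 1) : D) ∈ S := by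
    intro n
    have mu := meven n
    have e := c4 ((n : ℤ) + 1)
    obtain ⟨p, hp, q, hq, e1, e2⟩ := main n
    have e3 : (R (2 * ((n : ℤ) + 1) + 1) : D) =
        R (2 * ((n : ℤ) + 1)) * A * R (2 * ((n : ℤ) + 1)) + p * (B ^ n * s)
          + R (2 * ((n : ℤ) + 1)) * q := by
      have hs : A ^ n * Y * B ^ n * s = ((C⁻¹ : Dˣ) : D) := by rw [key n, hYs]
      rw [eq_sub_of_add_eq e.symm, e2, ← hs]
      have e4 : A ^ n * Y = R (2 * ((n : ℤ) + 1)) - p := by rw [e1]; abel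
      rw [e4]
      simp only [mul_add, sub_mul, mul_assoc]
      abel
    rw [e3]
    exact add_mem (add_mem (mul_mem (mul_mem mu mA) mu)
      (mul_mem hp (mul_mem (pow_mem mB _) ms))) (mul_mem mu hq)
  constructor
  · intro n hn
    rcases Int.even_or_odd' n with ⟨k, rfl | rfl⟩
    · rcases (show k = 0 ∨ 1 ≤ k by omega) with rfl | hk
      · rw [mul_zero, u0]
        simp only [Units.val_mul]
        exact add_mem (mul_mem (mul_mem (mul_mem mY mX) mYi) mYi)
          (mul_mem (mul_mem (mul_mem (mul_mem mY mX) mYi) mXi) mYi)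
      · obtain ⟨m, hm⟩ := Int.eq_ofNat_of_zero_le (show 0 ≤ k - 1 by omega)
        rw [show k = (m : ℤ) + 1 by omega]
        exact meven m
    · rcases (show k = 0 ∨ 1 ≤ k by omega) with rfl | hk
      · rw [mul_zero, zero_add, hR1]
        simp only [Units.val_mul]
        exact mul_mem (mul_mem mY mX) mYi
      · obtain ⟨m, hm⟩ := Int.eq_ofNat_of_zero_le (show 0 ≤ k - 1 by omega)
        rw [show k = (m : ℤ) + 1 by omega]
        exact modd m
  · intro k hk
    refine ⟨R (2 * k + 1), ?_, c4 k, rfl⟩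
    obtain ⟨m, hm⟩ := Int.eq_ofNat_of_zero_le (show 0 ≤ k - 1 by omega)
    rw [show k = (m : ℤ) + 1 by omega]
    exact modd m
end

section
/- Let D be a division ring, let (b,c) be either (1,4) or (4,1), and let (R, C) be a solution of the non-commutative (b,c)-system with commutator C. Then for every n ∈ ℤ (positive and negative), R_n belongs to the subsemiring of D generated by {C R₀, (C R₀)⁻¹, R₁, R₁⁻¹}, and R_n also belongs to the subsemiring of D generated by {C R₁, (C R₁)⁻¹, R₂, R₂⁻¹}. That is, every R_n is a non-commutative Laurent polynomial with non-negative integer coefficients both in the initial data (x, y) = (C R₀, R₁) and in the initial data (X, Y) = (C R₁, R₂). -/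
/-- A solution of the non-commutative `(b,c)`-system with commutator `C`. -/
def IsBCSolution {D : Type*} [DivisionRing D] (b c : ℕ) (R : ℤ → Dˣ) (C : Dˣ) : Prop :=
  (∀ n : ℤ, (C : D) =
      (((R (n + 1))⁻¹ : Dˣ) : D) * (R n : D) * (R (n + 1) : D) * (((R n)⁻¹ : Dˣ) : D)) ∧
  (∀ n : ℤ, Odd n → (R (n + 1) : D) * (C : D) * (R (n - 1) : D) = 1 + (R n : D) ^ b) ∧
  (∀ n : ℤ, Even n → (R (n + 1) : D) * (C : D) * (R (n - 1) : D) = 1 + (R n : D) ^ c)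


section Helpers

set_option linter.unusedSimpArgs false

variable {D : Type*} [DivisionRing D]

/-- Abstract positivity lemma for a three-term linear recursion. -/
lemma core_positivity (S : Subsemiring D) (U : ℕ → D) (u α C : Dˣ) (a e d a1 e1 d1 : D)
    (hu : (u : D) ∈ S) (hui : ((u⁻¹ : Dˣ) : D) ∈ S) (hα : (α : D) ∈ S)
    (hαi : ((α⁻¹ : Dˣ) : D) ∈ S) (hC : (C : D) ∈ S) (hCi : ((C⁻¹ : Dˣ) : D) ∈ S)
    (ha1 : a1 ∈ S) (he1 : e1 ∈ S) (hd : d ∈ S) (hd1 : d1 ∈ S)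
    (ha : a = α + a1) (he : e = ((u⁻¹ * α⁻¹ * u : Dˣ) : D) + e1)
    (hea : e * a = C + d) (hdu : d * u = (((C * α * u)⁻¹ : Dˣ) : D) + d1)
    (h0 : U 0 = u) (h1 : U 1 = a * u)
    (hrec : ∀ m, U (m + 2) + C * U m = (a + e) * U (m + 1)) :
    (∀ m, U m ∈ S) ∧ ∀ m, ∃ z ∈ S, U (m + 2) * C * U (m + 1) = 1 + z := by
  have haS : a ∈ S := ha ▸ S.add_mem hα ha1
  have hε : ((u⁻¹ * α⁻¹ * u : Dˣ) : D) ∈ S := by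
    simp only [Units.val_mul, Units.val_pow_eq_pow_val]
    exact S.mul_mem (S.mul_mem hui hαi) hu
  have heS : e ∈ S := he ▸ S.add_mem hε he1
  have hαp : ∀ m : ℕ, ((α ^ m * u : Dˣ) : D) ∈ S := fun m => by
    simp only [Units.val_mul, Units.val_pow_eq_pow_val]
    exact S.mul_mem (S.pow_mem hα m) hu
  have hαpi : ∀ m : ℕ, (((C * α ^ m * u)⁻¹ : Dˣ) : D) ∈ S := fun m => by
    have : ((C * α ^ m * u)⁻¹ : Dˣ) = u⁻¹ * ((α⁻¹) ^ m * C⁻¹) := by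
      simp [mul_inv_rev, mul_assoc]
    rw [this]
    simp only [Units.val_mul, Units.val_pow_eq_pow_val]
    exact S.mul_mem hui (S.mul_mem (S.pow_mem hαi m) hCi)
  have key : ∀ m : ℕ, ∃ p ∈ S, ∃ q ∈ S, U (m + 1) = ((α ^ (m + 1) * u : Dˣ) : D) + p ∧
      U (m + 2) = a * U (m + 1) + ((((C * α ^ (m + 1) * u)⁻¹ : Dˣ) : D) + q) := by
    intro m
    induction m with
    | zero =>
      refine ⟨a1 * u, S.mul_mem ha1 hu, d1, hd1, ?_, ?_⟩
      · rw [h1, ha]; simp [add_mul]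
      · have h2 := hrec 0
        have h3 : e * (a * u) = C * u + d * u := by rw [← mul_assoc, hea, add_mul]
        rw [h0] at h2
        simp only [zero_add, pow_one] at h2 ⊢
        rw [← hdu]
        rw [add_mul] at h2
        nth_rewrite 2 [h1] at h2
        rw [h3] at h2
        have : U 2 + C * u = (a * U 1 + d * u) + C * u := by rw [h2]; abel
        exact add_right_cancel this
    | succ m ih =>
      obtain ⟨p, hp, q, hq, h1', h2'⟩ := ih
      have hU1 : U (m + 1) ∈ S := h1' ▸ S.add_mem (hαp _) hp
      have hW := S.add_mem (hαpi (m + 1)) hq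
      refine ⟨α * p + a1 * U (m + 1) + ((((C * α ^ (m + 1) * u)⁻¹ : Dˣ) : D) + q),
        S.add_mem (S.add_mem (S.mul_mem hα hp) (S.mul_mem ha1 hU1)) hW,
        d * U (m + 1) + ((u⁻¹ * α⁻¹ * u : Dˣ) : D) * q
          + e1 * ((((C * α ^ (m + 1) * u)⁻¹ : Dˣ) : D) + q),
        S.add_mem (S.add_mem (S.mul_mem hd hU1) (S.mul_mem hε hq)) (S.mul_mem he1 hW), ?_, ?_⟩
      · have : a * U (m + 1) = ((α ^ (m + 2) * u : Dˣ) : D) + α * p + a1 * U (m + 1) := by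
          nth_rewrite 1 [ha]
          rw [add_mul]
          nth_rewrite 1 [h1']
          rw [mul_add, pow_succ' α (m + 1)]
          push_cast
          simp only [mul_assoc]
        rw [show m + 1 + 1 = m + 2 from rfl, h2', this]
        abel
      · have h3 := hrec (m + 1)
        have hmono : ((u⁻¹ * α⁻¹ * u : Dˣ) : D) * (((C * α ^ (m + 1) * u)⁻¹ : Dˣ) : D)
            = (((C * α ^ (m + 2) * u)⁻¹ : Dˣ) : D) := by
          rw [← Units.val_mul]
          congr 1
          rw [pow_succ α (m + 1)]
          simp only [mul_inv_rev, mul_assoc, mul_inv_cancel_left]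
        have h4 : e * U (m + 2) = C * U (m + 1) + d * U (m + 1) +
            e * ((((C * α ^ (m + 1) * u)⁻¹ : Dˣ) : D) + q) := by
          rw [h2', mul_add, ← mul_assoc, hea, add_mul]
        have h5 : e * ((((C * α ^ (m + 1) * u)⁻¹ : Dˣ) : D) + q) =
            (((C * α ^ (m + 2) * u)⁻¹ : Dˣ) : D) + ((u⁻¹ * α⁻¹ * u : Dˣ) : D) * q
             + e1 * ((((C * α ^ (m + 1) * u)⁻¹ : Dˣ) : D) + q) := by
          rw [he, add_mul, mul_add, hmono]
        rw [h5] at h4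
        rw [add_mul] at h3
        rw [show m + 1 + 1 = m + 2 from rfl] at h3 ⊢
        rw [h4] at h3
        refine add_right_cancel (b := (C : D) * U (m + 1)) ?_
        rw [h3]
        abel
  have hS : ∀ m, U m ∈ S := by
    intro m
    cases m with
    | zero => rw [h0]; exact hu
    | succ m =>
      obtain ⟨p, hp, q, hq, h1', h2'⟩ := key m
      exact h1' ▸ S.add_mem (hαp _) hp
  refine ⟨hS, fun m => ?_⟩
  obtain ⟨p, hp, q, hq, h1', h2'⟩ := key m
  refine ⟨(a * U (m + 1) + q) * C * U (m + 1) + (((C * α ^ (m + 1) * u)⁻¹ : Dˣ) : D) * C * p,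
    S.add_mem (S.mul_mem (S.mul_mem (S.add_mem (S.mul_mem haS (hS _)) hq) hC) (hS _))
      (S.mul_mem (S.mul_mem (hαpi _) hC) hp), ?_⟩
  have h6 : (((C * α ^ (m + 1) * u)⁻¹ : Dˣ) : D) * C * U (m + 1) =
      1 + (((C * α ^ (m + 1) * u)⁻¹ : Dˣ) : D) * C * p := by
    nth_rewrite 1 [h1']
    rw [mul_add, ← Units.val_mul, ← Units.val_mul]
    congr 1
    rw [show (C * α ^ (m + 1) * u)⁻¹ * C * (α ^ (m + 1) * u) = (1 : Dˣ) by group]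
    rfl
  have h7 : U (m + 2) * C * U (m + 1) = (a * U (m + 1) + q) * C * U (m + 1) +
      (((C * α ^ (m + 1) * u)⁻¹ : Dˣ) : D) * C * U (m + 1) := by
    rw [h2']
    simp only [add_mul]
    abel
  rw [h7, h6]
  abel

variable {R : ℤ → Dˣ} {C : Dˣ}

lemma comm_units {b c : ℕ} (h : IsBCSolution b c R C) (n : ℤ) :
    C = (R (n + 1))⁻¹ * R n * R (n + 1) * (R n)⁻¹ := by
  apply Units.ext
  rw [h.1 n]
  push_cast
  rfl

/-- The next term, as an expression in the two preceding ones. -/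
lemma next_eq {b c : ℕ} (h : IsBCSolution b c R C) (n : ℤ) (k : ℕ)
    (hk : (R (n + 1) : D) * (C : D) * (R (n - 1) : D) = 1 + (R n : D) ^ k) :
    (R (n + 1) : D) = (1 + (R n : D) ^ k) * ((R n)⁻¹ : Dˣ) * ((R (n - 1))⁻¹ : Dˣ) * R n := by
  have hc := comm_units h (n - 1)
  rw [sub_add_cancel] at hc
  rw [← hk, hc]
  push_cast
  simp [mul_assoc]

/-- The previous term, as an expression in the two following ones. -/
lemma prev_eq {b c : ℕ} (h : IsBCSolution b c R C) (n : ℤ) (k : ℕ)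
    (hk : (R (n + 1) : D) * (C : D) * (R (n - 1) : D) = 1 + (R n : D) ^ k) :
    (R (n - 1) : D) = R n * ((R (n + 1))⁻¹ : Dˣ) * ((R n)⁻¹ : Dˣ) * (1 + (R n : D) ^ k) := by
  have hc := comm_units h n
  rw [← hk, hc]
  push_cast
  simp [mul_assoc]

/-- The conserved quantity. -/
def KK (y v x : Dˣ) : D := x * x * (v⁻¹ : Dˣ) + (v⁻¹ : Dˣ) * y * y

lemma KK_left (y v x C : Dˣ) (ym vm : D) (hC : C = v⁻¹ * y * v * y⁻¹)
    (hx : (x : D) = (1 + v) * (v⁻¹ : Dˣ) * (y⁻¹ : Dˣ) * v)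
    (hvm : vm = y * (v⁻¹ : Dˣ) * (y⁻¹ : Dˣ) * (1 + (y : D) ^ 4))
    (hym : (ym : D) * y = vm + (C⁻¹ : Dˣ)) :
    (x : D) + C * ym = KK y v x * y := by
  have hym' : ym = (vm + (C⁻¹ : Dˣ)) * (y⁻¹ : Dˣ) := by rw [← hym]; simp [mul_assoc]
  rw [hym', hvm, KK, hx, hC]
  simp only [mul_inv_rev, inv_inv, Units.val_mul, mul_add, add_mul, mul_assoc, pow_succ, pow_zero,
    one_mul, mul_one, Units.mul_inv, Units.inv_mul, Units.mul_inv_cancel_left,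
    Units.inv_mul_cancel_left]
  abel

lemma KK_right (y v x C : Dˣ) (xp vp : D) (hC : C = x⁻¹ * v * x * v⁻¹)
    (hy : (y : D) = v * (x⁻¹ : Dˣ) * (v⁻¹ : Dˣ) * (1 + v))
    (hvp : vp = (1 + (x : D) ^ 4) * (x⁻¹ : Dˣ) * (v⁻¹ : Dˣ) * x)
    (hxp : (x : D) * xp = vp + (C⁻¹ : Dˣ)) :
    xp + C * y = KK y v x * x := by
  have hxp' : xp = (x⁻¹ : Dˣ) * (vp + (C⁻¹ : Dˣ)) := by rw [← hxp]; simp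
  rw [hxp', hvp, KK, hy, hC]
  simp only [mul_inv_rev, inv_inv, Units.val_mul, mul_add, add_mul, mul_assoc, pow_succ, pow_zero,
    one_mul, mul_one, Units.mul_inv, Units.inv_mul, Units.mul_inv_cancel_left,
    Units.inv_mul_cancel_left]
  abel

/-- `u_m u_{m+1} = v_m + C⁻¹`. -/
lemma prod_eq (h : IsBCSolution 1 4 R C) (n : ℤ) (hn : Odd n) :
    (R (n - 1) : D) * R (n + 1) = R n + (C⁻¹ : Dˣ) := by
  have h1 := next_eq h n 1 (h.2.1 n hn)
  have hc := comm_units h (n - 1)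
  rw [sub_add_cancel] at hc
  rw [h1, hc]
  simp only [mul_inv_rev, inv_inv, Units.val_mul, mul_add, add_mul, mul_assoc, pow_one,
    one_mul, mul_one, Units.mul_inv, Units.inv_mul, Units.mul_inv_cancel_left,
    Units.inv_mul_cancel_left]
  abel

lemma rec_right (h : IsBCSolution 1 4 R C) (n : ℤ) (hn : Even n) :
    (R (n + 2) : D) + C * R (n - 2) = KK (R (n - 2)) (R (n - 1)) (R n) * R n := by
  have hv := next_eq h n 4 (h.2.2 n hn)
  have hodd : Odd (n - 1) := hn.sub_odd odd_one
  have hodd' : Odd (n + 1) := hn.add_odd odd_one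
  have hy := prev_eq h (n - 1) 1 (h.2.1 _ hodd)
  have hc := comm_units h (n - 1)
  have hp := prod_eq h (n + 1) hodd'
  rw [sub_add_cancel] at hc hy
  rw [show n - 1 - 1 = n - 2 by ring, pow_one] at hy
  rw [show n + 1 - 1 = n by ring, show n + 1 + 1 = n + 2 by ring] at hp
  exact KK_right _ _ _ _ _ _ hc hy hv hp

lemma rec_left (h : IsBCSolution 1 4 R C) (n : ℤ) (hn : Even n) :
    (R (n + 2) : D) + C * R (n - 2) = KK (R n) (R (n + 1)) (R (n + 2)) * R n := by
  have hv := prev_eq h n 4 (h.2.2 n hn)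
  have hodd : Odd (n - 1) := hn.sub_odd odd_one
  have hodd' : Odd (n + 1) := hn.add_odd odd_one
  have hy := next_eq h (n + 1) 1 (h.2.1 _ hodd')
  have hc := comm_units h n
  have hp := prod_eq h (n - 1) hodd
  rw [show n + 1 - 1 = n by ring, show n + 1 + 1 = n + 2 by ring, pow_one] at hy
  rw [sub_add_cancel, show n - 1 - 1 = n - 2 by ring] at hp
  exact KK_left _ _ _ _ _ _ hc hy hv hp

lemma KK_const (h : IsBCSolution 1 4 R C) (m : ℕ) :
    KK (R (2 * m)) (R (2 * m + 1)) (R (2 * m + 2)) = KK (R 0) (R 1) (R 2) := by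
  induction m with
  | zero => simp
  | succ m ih =>
    have hev : Even (2 * (m : ℤ) + 2) := ⟨m + 1, by ring⟩
    have e1 := rec_left h _ hev
    rw [rec_right h _ hev] at e1
    have e2 := (Units.mul_left_inj _).1 e1
    rw [show 2 * (m : ℤ) + 2 - 2 = 2 * m by ring, show 2 * (m : ℤ) + 2 - 1 = 2 * m + 1 by ring,
      ih] at e2
    rw [e2]
    push_cast
    congr 2

lemma rec_const (h : IsBCSolution 1 4 R C) (m : ℕ) :
    (R (2 * m + 4) : D) + C * R (2 * m) = KK (R 0) (R 1) (R 2) * R (2 * m + 2) := by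
  have hev : Even (2 * (m : ℤ) + 2) := ⟨m + 1, by ring⟩
  have e1 := rec_right h _ hev
  rw [show 2 * (m : ℤ) + 2 - 2 = 2 * m by ring, show 2 * (m : ℤ) + 2 - 1 = 2 * m + 1 by ring,
    show 2 * (m : ℤ) + 2 + 2 = 2 * m + 4 by ring, KK_const h] at e1
  exact e1

/-- Forward positivity in the seed `(R 0, R 1)`. -/
lemma forward_A (h : IsBCSolution 1 4 R C) (S : Subsemiring D)
    (s0 : (R 0 : D) ∈ S) (s0i : (((R 0)⁻¹ : Dˣ) : D) ∈ S)
    (s1 : (R 1 : D) ∈ S) (s1i : (((R 1)⁻¹ : Dˣ) : D) ∈ S) (m : ℕ) :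
    (R (2 * m) : D) ∈ S ∧ (R (2 * m + 1) : D) ∈ S := by
  have hc : C = (R 1)⁻¹ * R 0 * R 1 * (R 0)⁻¹ := by simpa using comm_units h 0
  have h2 : (R 2 : D) = (1 + R 1) * ((R 1)⁻¹ : Dˣ) * ((R 0)⁻¹ : Dˣ) * R 1 := by
    simpa using next_eq h 1 1 (h.2.1 1 odd_one)
  have hrec := rec_const h
  have hodd : ∀ m : ℕ, (R (2 * m + 2) : D) * C * R (2 * m) = 1 + R (2 * m + 1) := fun m => by
    have := h.2.1 (2 * m + 1) ⟨m, rfl⟩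
    rw [pow_one, add_sub_cancel_right, add_assoc] at this
    exact this
  have hC : (C : D) ∈ S := by
    rw [hc]; simp only [Units.val_mul, Units.val_pow_eq_pow_val]
    exact S.mul_mem (S.mul_mem (S.mul_mem s1i s0) s1) s0i
  have hCi : ((C⁻¹ : Dˣ) : D) ∈ S := by
    rw [hc]; simp only [mul_inv_rev, inv_inv]; simp only [Units.val_mul, Units.val_pow_eq_pow_val]
    exact S.mul_mem s0 (S.mul_mem s1i (S.mul_mem s0i s1))
  generalize hu : R 0 = u at *
  generalize hv : R 1 = v at *
  have := core_positivity S (fun m => (R (2 * m) : D)) u (u⁻¹ * v * u⁻¹) C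
    ((u⁻¹ * v * u⁻¹ : Dˣ) + (u⁻¹ * C⁻¹ * u⁻¹ : Dˣ))
    ((u⁻¹ * (u⁻¹ * v * u⁻¹)⁻¹ * u : Dˣ) + ((v⁻¹ * u⁻¹ * u⁻¹ : Dˣ) + (u⁻¹ * u⁻¹ : Dˣ)))
    ((v⁻¹ * u * C⁻¹ * u⁻¹ : Dˣ) + ((v⁻¹ * u⁻¹ * u⁻¹ : Dˣ) + (u⁻¹ * u⁻¹ : Dˣ)) *
      ((u⁻¹ * v * u⁻¹ : Dˣ) + (u⁻¹ * C⁻¹ * u⁻¹ : Dˣ)))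
    (u⁻¹ * C⁻¹ * u⁻¹ : Dˣ) ((v⁻¹ * u⁻¹ * u⁻¹ : Dˣ) + (u⁻¹ * u⁻¹ : Dˣ))
    (((v⁻¹ * u⁻¹ * u⁻¹ : Dˣ) + (u⁻¹ * u⁻¹ : Dˣ)) *
      ((u⁻¹ * v * u⁻¹ : Dˣ) + (u⁻¹ * C⁻¹ * u⁻¹ : Dˣ)) * u)
    s0 s0i ?_ ?_ hC hCi ?_ ?_ ?_ ?_ rfl rfl ?_ ?_ ?_ ?_ ?_
  · obtain ⟨hA, hB⟩ := this
    refine ⟨hA m, ?_⟩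
    cases m with
    | zero => simpa [hv] using s1
    | succ m =>
      obtain ⟨z, hz, hz'⟩ := hB m
      have h3 := hodd (m + 1)
      rw [show 2 * ((m + 1 : ℕ) : ℤ) + 2 = 2 * ((m + 2 : ℕ) : ℤ) by push_cast; ring] at h3
      rw [hz'] at h3
      rw [← add_left_cancel h3]
      exact hz
  · simp only [Units.val_mul, Units.val_pow_eq_pow_val]
    exact S.mul_mem (S.mul_mem s0i s1) s0i
  · simp only [mul_inv_rev, inv_inv]; simp only [Units.val_mul, Units.val_pow_eq_pow_val]
    exact S.mul_mem s0 (S.mul_mem s1i s0)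
  · simp only [Units.val_mul, Units.val_pow_eq_pow_val]
    exact S.mul_mem (S.mul_mem s0i hCi) s0i
  · simp only [Units.val_mul, Units.val_pow_eq_pow_val]
    exact S.add_mem (S.mul_mem (S.mul_mem s1i s0i) s0i) (S.mul_mem s0i s0i)
  · simp only [Units.val_mul, Units.val_pow_eq_pow_val]
    exact S.add_mem (S.mul_mem (S.mul_mem (S.mul_mem s1i s0) hCi) s0i)
      (S.mul_mem (S.add_mem (S.mul_mem (S.mul_mem s1i s0i) s0i) (S.mul_mem s0i s0i))
        (S.add_mem (S.mul_mem (S.mul_mem s0i s1) s0i) (S.mul_mem (S.mul_mem s0i hCi) s0i)))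
  · simp only [Units.val_mul, Units.val_pow_eq_pow_val]
    exact S.mul_mem
      (S.mul_mem (S.add_mem (S.mul_mem (S.mul_mem s1i s0i) s0i) (S.mul_mem s0i s0i))
        (S.add_mem (S.mul_mem (S.mul_mem s0i s1) s0i) (S.mul_mem (S.mul_mem s0i hCi) s0i))) s0
  · rw [hc]
    simp only [mul_inv_rev, inv_inv, Units.val_mul, mul_add, add_mul, mul_assoc, pow_succ, pow_zero,
      one_mul, mul_one, Units.mul_inv, Units.inv_mul, Units.mul_inv_cancel_left,
      Units.inv_mul_cancel_left]
    abel
  · rw [hc]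
    simp only [mul_inv_rev, inv_inv, Units.val_mul, mul_add, add_mul, mul_assoc, pow_succ, pow_zero,
      one_mul, mul_one, Units.mul_inv, Units.inv_mul, Units.mul_inv_cancel_left,
      Units.inv_mul_cancel_left]
  · simp [hu]
  · simp only [Nat.cast_one, mul_one]
    rw [h2, hc]
    simp only [mul_inv_rev, inv_inv, Units.val_mul, mul_add, add_mul, mul_assoc, pow_succ, pow_zero,
      one_mul, mul_one, Units.mul_inv, Units.inv_mul, Units.mul_inv_cancel_left,
      Units.inv_mul_cancel_left]
    abel
  · intro m
    have h3 := hrec m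
    simp only [Nat.cast_add, Nat.cast_one, Nat.cast_ofNat]
    rw [show 2 * ((m : ℤ) + 2) = 2 * m + 4 by ring, show 2 * ((m : ℤ) + 1) = 2 * m + 2 by ring, h3]
    congr 1
    rw [KK, h2, hc]
    simp only [mul_inv_rev, inv_inv, Units.val_mul, mul_add, add_mul, mul_assoc, pow_succ, pow_zero,
      one_mul, mul_one, Units.mul_inv, Units.inv_mul, Units.mul_inv_cancel_left,
      Units.inv_mul_cancel_left]
    abel

/-- Forward positivity in the seed `(R 1, R 2)`. -/
lemma forward_B (h : IsBCSolution 1 4 R C) (S : Subsemiring D)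
    (s0 : (R 2 : D) ∈ S) (s0i : (((R 2)⁻¹ : Dˣ) : D) ∈ S)
    (s1 : (R 1 : D) ∈ S) (s1i : (((R 1)⁻¹ : Dˣ) : D) ∈ S) (m : ℕ) :
    (R (2 * m + 2) : D) ∈ S ∧ (R (2 * m + 3) : D) ∈ S := by
  have hc : C = (R 2)⁻¹ * R 1 * R 2 * (R 1)⁻¹ := by simpa using comm_units h 1
  have h3 : (R 3 : D) = (1 + (R 2 : D) ^ 4) * ((R 2)⁻¹ : Dˣ) * ((R 1)⁻¹ : Dˣ) * R 2 := by
    simpa using next_eq h 2 4 (h.2.2 2 even_two)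
  have h4 : (R 2 : D) * R 4 = R 3 + (C⁻¹ : Dˣ) := by
    simpa using prod_eq h 3 ⟨1, rfl⟩
  have h0 : (R 0 : D) = R 1 * ((R 2)⁻¹ : Dˣ) * ((R 1)⁻¹ : Dˣ) * (1 + R 1) := by
    simpa using prev_eq h 1 1 (h.2.1 1 odd_one)
  have hrec := rec_const h
  have hodd : ∀ m : ℕ, (R (2 * m + 4) : D) * C * R (2 * m + 2) = 1 + R (2 * m + 3) := fun m => by
    have := h.2.1 (2 * m + 3) ⟨m + 1, by ring⟩
    rw [pow_one, show 2 * (m : ℤ) + 3 - 1 = 2 * m + 2 by ring, add_assoc] at this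
    exact this
  have hC : (C : D) ∈ S := by
    rw [hc]; simp only [Units.val_mul, Units.val_pow_eq_pow_val]
    exact S.mul_mem (S.mul_mem (S.mul_mem s0i s1) s0) s1i
  have hCi : ((C⁻¹ : Dˣ) : D) ∈ S := by
    rw [hc]; simp only [mul_inv_rev, inv_inv]; simp only [Units.val_mul, Units.val_pow_eq_pow_val]
    exact S.mul_mem s1 (S.mul_mem s0i (S.mul_mem s1i s0))
  have h3S : (R 3 : D) ∈ S := by
    rw [h3]
    exact S.mul_mem (S.mul_mem (S.mul_mem (S.add_mem S.one_mem (S.pow_mem s0 4)) s0i) s1i) s0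
  have h4' : (R 4 : D) = ((R 2)⁻¹ : Dˣ) * (R 3 + (C⁻¹ : Dˣ)) := by
    rw [← h4, Units.inv_mul_cancel_left]
  generalize hu : R 2 = u at *
  generalize hv : R 1 = v at *
  have := core_positivity S (fun m => (R (2 * m + 2) : D)) u (u * u * v⁻¹) C
    ((u * u * v⁻¹ : Dˣ) + ((u⁻¹ * u⁻¹ * v⁻¹ : Dˣ) + (u⁻¹ * C⁻¹ * u⁻¹ : Dˣ)))
    ((u⁻¹ * (u * u * v⁻¹)⁻¹ * u : Dˣ) + (u⁻¹ * u⁻¹ : Dˣ))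
    ((u⁻¹ * v * u⁻¹ * u⁻¹ * C⁻¹ * u⁻¹ : Dˣ) + ((u⁻¹ * v * u⁻¹ * u⁻¹ * u⁻¹ * v⁻¹ : Dˣ) +
      (u⁻¹ * u⁻¹ : Dˣ) *
      ((u * u * v⁻¹ : Dˣ) + ((u⁻¹ * u⁻¹ * v⁻¹ : Dˣ) + (u⁻¹ * C⁻¹ * u⁻¹ : Dˣ)))))
    ((u⁻¹ * u⁻¹ * v⁻¹ : Dˣ) + (u⁻¹ * C⁻¹ * u⁻¹ : Dˣ)) (u⁻¹ * u⁻¹ : Dˣ)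
    (((u⁻¹ * v * u⁻¹ * u⁻¹ * u⁻¹ * v⁻¹ : Dˣ) +
      (u⁻¹ * u⁻¹ : Dˣ) *
      ((u * u * v⁻¹ : Dˣ) + ((u⁻¹ * u⁻¹ * v⁻¹ : Dˣ) + (u⁻¹ * C⁻¹ * u⁻¹ : Dˣ)))) * u)
    s0 s0i ?_ ?_ hC hCi ?_ ?_ ?_ ?_ rfl rfl ?_ ?_ ?_ ?_ ?_
  · obtain ⟨hA, hB⟩ := this
    refine ⟨hA m, ?_⟩
    cases m with
    | zero => simpa using h3S
    | succ m =>
      obtain ⟨z, hz, hz'⟩ := hB m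
      have h3 := hodd (m + 1)
      rw [show 2 * ((m + 1 : ℕ) : ℤ) + 4 = 2 * ((m + 2 : ℕ) : ℤ) + 2 by push_cast; ring] at h3
      rw [hz'] at h3
      rw [← add_left_cancel h3]
      exact hz
  · simp only [Units.val_mul, Units.val_pow_eq_pow_val]
    exact S.mul_mem (S.mul_mem s0 s0) s1i
  · simp only [mul_inv_rev, inv_inv]; simp only [Units.val_mul, Units.val_pow_eq_pow_val]
    exact S.mul_mem s1 (S.mul_mem s0i s0i)
  · simp only [Units.val_mul, Units.val_pow_eq_pow_val]
    exact S.add_mem (S.mul_mem (S.mul_mem s0i s0i) s1i) (S.mul_mem (S.mul_mem s0i hCi) s0i)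
  · simp only [Units.val_mul, Units.val_pow_eq_pow_val]
    exact S.mul_mem s0i s0i
  · simp only [Units.val_mul, Units.val_pow_eq_pow_val]
    have q1 := S.mul_mem (S.mul_mem (S.mul_mem s0i s1) s0i) s0i
    exact S.add_mem (S.mul_mem (S.mul_mem q1 hCi) s0i)
      (S.add_mem (S.mul_mem (S.mul_mem q1 s0i) s1i) (S.mul_mem (S.mul_mem s0i s0i)
        (S.add_mem (S.mul_mem (S.mul_mem s0 s0) s1i)
        (S.add_mem (S.mul_mem (S.mul_mem s0i s0i) s1i) (S.mul_mem (S.mul_mem s0i hCi) s0i)))))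
  · simp only [Units.val_mul, Units.val_pow_eq_pow_val]
    have q1 := S.mul_mem (S.mul_mem (S.mul_mem s0i s1) s0i) s0i
    exact S.mul_mem
      (S.add_mem (S.mul_mem (S.mul_mem q1 s0i) s1i) (S.mul_mem (S.mul_mem s0i s0i)
        (S.add_mem (S.mul_mem (S.mul_mem s0 s0) s1i)
        (S.add_mem (S.mul_mem (S.mul_mem s0i s0i) s1i) (S.mul_mem (S.mul_mem s0i hCi) s0i))))) s0
  · rw [hc]
    simp only [mul_inv_rev, inv_inv, Units.val_mul, mul_add, add_mul, mul_assoc, pow_succ, pow_zero,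
      one_mul, mul_one, Units.mul_inv, Units.inv_mul, Units.mul_inv_cancel_left,
      Units.inv_mul_cancel_left]
    abel
  · rw [hc]
    simp only [mul_inv_rev, inv_inv, Units.val_mul, mul_add, add_mul, mul_assoc, pow_succ, pow_zero,
      one_mul, mul_one, Units.mul_inv, Units.inv_mul, Units.mul_inv_cancel_left,
      Units.inv_mul_cancel_left]
  · simp [hu]
  · simp only [Nat.cast_one, mul_one]
    rw [show (2 : ℤ) + 2 = 4 by norm_num, h4', h3, hc]
    simp only [mul_inv_rev, inv_inv, Units.val_mul, mul_add, add_mul, mul_assoc, pow_succ, pow_zero,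
      one_mul, mul_one, Units.mul_inv, Units.inv_mul, Units.mul_inv_cancel_left,
      Units.inv_mul_cancel_left]
    abel
  · intro m
    have h3 := hrec (m + 1)
    simp only [Nat.cast_add, Nat.cast_one, Nat.cast_ofNat] at h3 ⊢
    rw [show 2 * ((m : ℤ) + 2) + 2 = 2 * (m + 1) + 4 by ring,
      show 2 * (m : ℤ) + 2 = 2 * (m + 1) by ring, h3]
    congr 1
    rw [KK, h0, hc]
    simp only [mul_inv_rev, inv_inv, Units.val_mul, mul_add, add_mul, mul_assoc, pow_succ, pow_zero,
      one_mul, mul_one, Units.mul_inv, Units.inv_mul, Units.mul_inv_cancel_left,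
      Units.inv_mul_cancel_left]
    abel

lemma forward_A' (h : IsBCSolution 1 4 R C) (S : Subsemiring D)
    (s0 : (R 0 : D) ∈ S) (s0i : (((R 0)⁻¹ : Dˣ) : D) ∈ S)
    (s1 : (R 1 : D) ∈ S) (s1i : (((R 1)⁻¹ : Dˣ) : D) ∈ S) (n : ℤ) (hn : 0 ≤ n) :
    (R n : D) ∈ S := by
  lift n to ℕ using hn
  obtain ⟨m, hm | hm⟩ := Nat.even_or_odd' n
  · rw [hm]; exact_mod_cast (forward_A h S s0 s0i s1 s1i m).1
  · rw [hm]; exact_mod_cast (forward_A h S s0 s0i s1 s1i m).2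

lemma forward_B' (h : IsBCSolution 1 4 R C) (S : Subsemiring D)
    (s0 : (R 2 : D) ∈ S) (s0i : (((R 2)⁻¹ : Dˣ) : D) ∈ S)
    (s1 : (R 1 : D) ∈ S) (s1i : (((R 1)⁻¹ : Dˣ) : D) ∈ S) (n : ℤ) (hn : 1 ≤ n) :
    (R n : D) ∈ S := by
  rcases hn.eq_or_lt with rfl | hn
  · exact s1
  obtain ⟨k, hk⟩ : ∃ k : ℕ, n = k + 2 := ⟨(n - 2).toNat, by omega⟩
  obtain ⟨m, hm | hm⟩ := Nat.even_or_odd' k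
  · have := (forward_B h S s0 s0i s1 s1i m).1
    rwa [show n = 2 * (m : ℤ) + 2 by omega]
  · have := (forward_B h S s0 s0i s1 s1i m).2
    rwa [show n = 2 * (m : ℤ) + 3 by omega]

/-- The reversed sequence, as units of the opposite ring. -/
def revSeq (R : ℤ → Dˣ) (n : ℤ) : Dᵐᵒᵖˣ := Units.opEquiv.symm (MulOpposite.op (R (2 - n)))

lemma revSeq_val (n : ℤ) : ((revSeq R n : Dᵐᵒᵖˣ) : Dᵐᵒᵖ) = MulOpposite.op (R (2 - n) : D) := rfl

lemma revSeq_inv (n : ℤ) :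
    (((revSeq R n)⁻¹ : Dᵐᵒᵖˣ) : Dᵐᵒᵖ) = MulOpposite.op (((R (2 - n))⁻¹ : Dˣ) : D) := rfl

lemma revSeq_sol (h : IsBCSolution 1 4 R C) :
    IsBCSolution 1 4 (revSeq R) (Units.opEquiv.symm (MulOpposite.op C)) := by
  have hCv : ((Units.opEquiv.symm (MulOpposite.op C) : Dᵐᵒᵖˣ) : Dᵐᵒᵖ) = MulOpposite.op (C : D) :=
    rfl
  refine ⟨fun n => ?_, fun n hn => ?_, fun n hn => ?_⟩
  · have := h.1 (2 - (n + 1))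
    rw [show 2 - (n + 1) + 1 = 2 - n by ring] at this
    rw [hCv, revSeq_val, revSeq_val, revSeq_inv, revSeq_inv, this]
    simp only [← MulOpposite.op_mul, mul_assoc]
  · have := h.2.1 (2 - n) (even_two.sub_odd hn)
    rw [show 2 - n + 1 = 2 - (n - 1) by ring, show 2 - n - 1 = 2 - (n + 1) by ring] at this
    rw [hCv, revSeq_val, revSeq_val, revSeq_val]
    simp only [← MulOpposite.op_mul, ← MulOpposite.op_pow, ← MulOpposite.op_one,
      ← MulOpposite.op_add]
    rw [← mul_assoc, this]
  · have := h.2.2 (2 - n) (even_two.sub hn)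
    rw [show 2 - n + 1 = 2 - (n - 1) by ring, show 2 - n - 1 = 2 - (n + 1) by ring] at this
    rw [hCv, revSeq_val, revSeq_val, revSeq_val]
    simp only [← MulOpposite.op_mul, ← MulOpposite.op_pow, ← MulOpposite.op_one,
      ← MulOpposite.op_add]
    rw [← mul_assoc, this]

lemma all_A (h : IsBCSolution 1 4 R C) (S : Subsemiring D)
    (s0 : (R 0 : D) ∈ S) (s0i : (((R 0)⁻¹ : Dˣ) : D) ∈ S)
    (s1 : (R 1 : D) ∈ S) (s1i : (((R 1)⁻¹ : Dˣ) : D) ∈ S) (n : ℤ) :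
    (R n : D) ∈ S := by
  rcases le_total 0 n with hn | hn
  · exact forward_A' h S s0 s0i s1 s1i n hn
  · have := forward_B' (revSeq_sol h) S.op
      (by rw [revSeq_val, Subsemiring.mem_op]; simpa using s0)
      (by rw [revSeq_inv, Subsemiring.mem_op]; simpa using s0i)
      (by rw [revSeq_val, Subsemiring.mem_op]; simpa using s1)
      (by rw [revSeq_inv, Subsemiring.mem_op]; simpa using s1i) (2 - n) (by omega)
    rw [revSeq_val, Subsemiring.mem_op, sub_sub_cancel] at this
    exact this

lemma all_B (h : IsBCSolution 1 4 R C) (S : Subsemiring D)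
    (s1 : (R 1 : D) ∈ S) (s1i : (((R 1)⁻¹ : Dˣ) : D) ∈ S)
    (s2 : (R 2 : D) ∈ S) (s2i : (((R 2)⁻¹ : Dˣ) : D) ∈ S) (n : ℤ) :
    (R n : D) ∈ S := by
  rcases le_total 1 n with hn | hn
  · exact forward_B' h S s2 s2i s1 s1i n hn
  · have := forward_A' (revSeq_sol h) S.op
      (by rw [revSeq_val, Subsemiring.mem_op]; simpa using s2)
      (by rw [revSeq_inv, Subsemiring.mem_op]; simpa using s2i)
      (by rw [revSeq_val, Subsemiring.mem_op]; simpa using s1)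
      (by rw [revSeq_inv, Subsemiring.mem_op]; simpa using s1i) (2 - n) (by omega)
    rw [revSeq_val, Subsemiring.mem_op, sub_sub_cancel] at this
    exact this

lemma shift_sol {b c : ℕ} (h : IsBCSolution b c R C) (k : ℤ) (hk : Odd k) :
    IsBCSolution c b (fun n => R (n + k)) C := by
  refine ⟨fun n => ?_, fun n hn => ?_, fun n hn => ?_⟩
  · have := h.1 (n + k)
    rwa [show n + k + 1 = n + 1 + k by ring] at this
  · have := h.2.2 (n + k) (hn.add_odd hk)
    rwa [show n + k + 1 = n + 1 + k by ring, show n + k - 1 = n - 1 + k by ring] at this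
  · have := h.2.1 (n + k) (hn.add_odd hk)
    rwa [show n + k + 1 = n + 1 + k by ring, show n + k - 1 = n - 1 + k by ring] at this

/-- The closure contains the seed variables and their inverses. -/
lemma seed_mem {b c : ℕ} (h : IsBCSolution b c R C) (n : ℤ) (S : Subsemiring D)
    (hS : S = Subsemiring.closure
        ({((C * R n : Dˣ) : D), (((C * R n)⁻¹ : Dˣ) : D),
          (R (n + 1) : D), (((R (n + 1))⁻¹ : Dˣ) : D)} : Set D)) :
    (R n : D) ∈ S ∧ (((R n)⁻¹ : Dˣ) : D) ∈ S ∧ (R (n + 1) : D) ∈ S ∧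
      (((R (n + 1))⁻¹ : Dˣ) : D) ∈ S := by
  have m1 : ((C * R n : Dˣ) : D) ∈ S := hS ▸ Subsemiring.subset_closure (by simp)
  have m2 : (((C * R n)⁻¹ : Dˣ) : D) ∈ S := hS ▸ Subsemiring.subset_closure (by simp)
  have m3 : (R (n + 1) : D) ∈ S := hS ▸ Subsemiring.subset_closure (by simp)
  have m4 : (((R (n + 1))⁻¹ : Dˣ) : D) ∈ S := hS ▸ Subsemiring.subset_closure (by simp)
  have hc := comm_units h n
  have e1 : R n = R (n + 1) * (C * R n) * (R (n + 1))⁻¹ := by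
    rw [hc]; group
  have e2 : (R n)⁻¹ = R (n + 1) * (C * R n)⁻¹ * (R (n + 1))⁻¹ := by
    rw [hc]; group
  refine ⟨?_, ?_, m3, m4⟩
  · rw [e1, Units.val_mul, Units.val_mul]
    exact S.mul_mem (S.mul_mem m3 m1) m4
  · rw [e2, Units.val_mul, Units.val_mul]
    exact S.mul_mem (S.mul_mem m3 m2) m4

end Helpers

/-- Main theorem (Kontsevich positivity in the affine cases): for `(b,c) = (1,4)` or
`(4,1)`, every `R_n` (`n ∈ ℤ`, positive or negative) is a non-commutative Laurent
polynomial with non-negative integer coefficients both in the initial data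
`(x, y) = (C R₀, R₁)` and in the initial data `(X, Y) = (C R₁, R₂)`. -/
theorem kontsevich_affine_positivity {D : Type*} [DivisionRing D] (b c : ℕ)
    (hbc : (b = 1 ∧ c = 4) ∨ (b = 4 ∧ c = 1))
    (R : ℤ → Dˣ) (C : Dˣ) (h : IsBCSolution b c R C) :
    ∀ n : ℤ,
      (R n : D) ∈ Subsemiring.closure
        ({((C * R 0 : Dˣ) : D), (((C * R 0)⁻¹ : Dˣ) : D),
          (R 1 : D), (((R 1)⁻¹ : Dˣ) : D)} : Set D) ∧
      (R n : D) ∈ Subsemiring.closure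
        ({((C * R 1 : Dˣ) : D), (((C * R 1)⁻¹ : Dˣ) : D),
          (R 2 : D), (((R 2)⁻¹ : Dˣ) : D)} : Set D) := by
  intro n
  obtain ⟨p0, p0i, p1, p1i⟩ := seed_mem h 0 _ rfl
  obtain ⟨q1, q1i, q2, q2i⟩ := seed_mem h 1 _ rfl
  rcases hbc with ⟨rfl, rfl⟩ | ⟨rfl, rfl⟩
  · exact ⟨all_A h _ p0 p0i p1 p1i n, all_B h _ q1 q1i q2 q2i n⟩
  · constructor
    · have h' := shift_sol h (-1) ⟨-1, by norm_num⟩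
      have := all_B h' _ p0 p0i p1 p1i (n + 1)
      simpa using this
    · have h' := shift_sol h 1 odd_one
      have := all_A h' _ q1 q1i q2 q2i (n - 1)
      simpa using this
end
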